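/- Let (R, m) be a commutative Noetherian local ring and M a nonzero finitely generated R-module with finite Gorenstein dimension. Then depth M + G-dim_R(M) = depth R. (Auslander–Bridger formula.) -/

import Mathlib

open CategoryTheory

universe u

/-- `Tor_i` over `R`, for bundled modules. -/
noncomputable def torM (R : Type u) [CommRing R] (i : ℕ) (M N : ModuleCat.{u} R) :
    ModuleCat.{u} R :=
  ((Tor (ModuleCat.{u} R) i).obj M).obj N

/-- `Tor_i^R(M, N)` for unbundled modules. -/
noncomputable def torMod (R : Type u) [CommRing R] (i : ℕ)
    (M N : Type u) [AddCommGroup M] [Module R M] [AddCommGroup N] [Module R N] :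
    ModuleCat.{u} R :=
  torM R i (ModuleCat.of R M) (ModuleCat.of R N)

/-- `M` and `N` are Tor-independent over `R`: `Tor_i^R(M,N) = 0` for all `i ≥ 1`. -/
def TorIndep (R : Type u) [CommRing R]
    (M N : Type u) [AddCommGroup M] [Module R M] [AddCommGroup N] [Module R N] : Prop :=
  ∀ i : ℕ, 1 ≤ i → Subsingleton (torMod R i M N)

/-- `Ext^i_R(M, N)` for unbundled modules. -/
noncomputable def extMod (R : Type u) [CommRing R] (i : ℕ)
    (M N : Type u) [AddCommGroup M] [Module R M] [AddCommGroup N] [Module R N] :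
    ModuleCat.{u} R :=
  ((Ext R (ModuleCat.{u} R) i).obj (Opposite.op (ModuleCat.of R M))).obj (ModuleCat.of R N)

/-- Depth of a module over a local ring: the least `i` with `Ext^i(k, M) ≠ 0`
(and `⊤` if all such Ext vanish, e.g. for the zero module). -/
noncomputable def eDepth (R : Type u) [CommRing R] [IsLocalRing R]
    (M : Type u) [AddCommGroup M] [Module R M] : ℕ∞ :=
  sInf {n : ℕ∞ | ∃ i : ℕ, n = (i : ℕ∞) ∧
    Nontrivial (extMod R i (IsLocalRing.ResidueField R) M)}

/-- A totally reflexive module: finitely generated, reflexive, and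
`Ext^i(M,R) = Ext^i(M*,R) = 0` for all `i ≥ 1`. -/
def TotReflexive (R : Type u) [CommRing R]
    (M : Type u) [AddCommGroup M] [Module R M] : Prop :=
  Module.Finite R M ∧ Module.IsReflexive R M ∧
    (∀ i : ℕ, 1 ≤ i → Subsingleton (extMod R i M R)) ∧
    (∀ i : ℕ, 1 ≤ i → Subsingleton (extMod R i (Module.Dual R M) R))

/-- `GdimLE R n M` : `M` admits a resolution of length `n` by totally reflexive modules. -/
inductive GdimLE (R : Type u) [CommRing R] : ℕ → ModuleCat.{u} R → Prop
  | zero (M : ModuleCat.{u} R) (h : TotReflexive R M) : GdimLE R 0 M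
  | succ (n : ℕ) (M K G : ModuleCat.{u} R) (hG : TotReflexive R G)
      (f : K ⟶ G) (g : G ⟶ M)
      (hf : Function.Injective f) (hfg : Function.Exact f g) (hg : Function.Surjective g)
      (hK : GdimLE R n K) : GdimLE R (n + 1) M

/-- Gorenstein dimension (Auslander–Bridger) of a module, as an extended natural number. -/
noncomputable def gdim (R : Type u) [CommRing R] (M : ModuleCat.{u} R) : ℕ∞ :=
  sInf {n : ℕ∞ | ∃ k : ℕ, n = (k : ℕ∞) ∧ GdimLE R k M}

lemma subsingleton_ext_zero_iff {R : Type u} [CommRing R] (X Y : ModuleCat.{u} R) :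
    Subsingleton (((Ext R (ModuleCat.{u} R) 0).obj (Opposite.op X)).obj Y) ↔
      Subsingleton (Abelian.Ext X Y 0) := by
  let P := projectiveResolution X
  rw [← ModuleCat.isZero_iff_subsingleton, (P.isoExt (R := R) 0 Y).isZero_iff,
    ← HomologicalComplex.exactAt_iff_isZero_homology,
    HomologicalComplex.exactAt_iff' _ 0 0 1 (by simp) (by simp), ShortComplex.moduleCat_exact_iff,
    Abelian.Ext.addEquiv₀.subsingleton_congr]
  let π : P.complex.X 0 ⟶ X := P.π.f 0
  have hdπ : P.complex.d 1 0 ≫ π = 0 := P.complex_d_comp_π_f_zero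
  have hπ : Epi π := inferInstanceAs (Epi (P.π.f 0))
  have hd : (P.complex.linearYonedaObj R Y).d 0 0 = 0 :=
    HomologicalComplex.shape _ _ _ (by simp)
  constructor
  · intro h
    refine subsingleton_of_forall_eq 0 fun f => ?_
    obtain ⟨g, hg⟩ := h (π ≫ f) (by
      change P.complex.d 1 0 ≫ π ≫ f = 0
      rw [← Category.assoc, hdπ, Limits.zero_comp])
    rw [← cancel_epi π, ← hg, Limits.comp_zero]
    change (P.complex.linearYonedaObj R Y).d 0 0 g = 0
    rw [hd]
    rfl
  · intro h f hf
    refine ⟨0, ?_⟩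
    rw [map_zero]
    let l : X ⟶ Y := P.isColimitCokernelCofork.desc (Limits.CokernelCofork.ofπ f hf)
    have hl : π ≫ l = f := P.isColimitCokernelCofork.fac (Limits.CokernelCofork.ofπ f hf) .one
    rw [← hl, Subsingleton.elim l 0, Limits.comp_zero]
    rfl

lemma subsingleton_ext_succ_iff {R : Type u} [CommRing R] (n : ℕ) (X Y : ModuleCat.{u} R) :
    Subsingleton (((Ext R (ModuleCat.{u} R) (n + 1)).obj (Opposite.op X)).obj Y) ↔
      Subsingleton (Abelian.Ext X Y (n + 1)) := by
  let P := projectiveResolution X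
  rw [← ModuleCat.isZero_iff_subsingleton, (P.isoExt (R := R) (n + 1) Y).isZero_iff,
    ← HomologicalComplex.exactAt_iff_isZero_homology,
    HomologicalComplex.exactAt_iff' _ n (n + 1) (n + 2) (by simp) (by simp),
    ShortComplex.moduleCat_exact_iff]
  constructor
  · intro h
    refine subsingleton_of_forall_eq 0 fun x => ?_
    obtain ⟨f, hf, rfl⟩ := P.extMk_surjective x (n + 2) rfl
    exact (P.extMk_eq_zero_iff f _ rfl hf n rfl).2 (h f hf)
  · intro h f hf
    exact (P.extMk_eq_zero_iff f _ rfl hf n rfl).1 (Subsingleton.elim _ _)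

lemma subsingleton_extMod_iff {R : Type u} [CommRing R] (i : ℕ) (M N : Type u)
    [AddCommGroup M] [Module R M] [AddCommGroup N] [Module R N] :
    Subsingleton (extMod R i M N) ↔
      Subsingleton (Abelian.Ext (ModuleCat.of R M) (ModuleCat.of R N) i) := by
  cases i with
  | zero => exact subsingleton_ext_zero_iff _ _
  | succ n => exact subsingleton_ext_succ_iff n _ _

open CategoryTheory.Abelian

section ShortExact

variable {C : Type*} [Category* C] [Abelian C] [HasExt C] {S : ShortComplex C}

lemma exists_comp_eq_of_subsingleton_ext_one (hS : S.ShortExact) {Y : C}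
    (h : Subsingleton (Ext S.X₃ Y 1)) (φ : S.X₁ ⟶ Y) : ∃ ψ : S.X₂ ⟶ Y, S.f ≫ ψ = φ := by
  obtain ⟨x, hx⟩ := Ext.contravariant_sequence_exact₁ hS Y (Ext.mk₀ φ) (n₁ := 1) rfl
    (Subsingleton.elim _ _)
  obtain ⟨ψ, rfl⟩ := (Ext.mk₀_bijective _ _).2 x
  exact ⟨ψ, (Ext.mk₀_bijective _ _).1 (by simpa using hx)⟩

lemma subsingleton_ext_one_of_forall_exists_comp_eq (hS : S.ShortExact) {Y : C}
    (h₂ : Subsingleton (Ext S.X₂ Y 1)) (h : ∀ φ : S.X₁ ⟶ Y, ∃ ψ : S.X₂ ⟶ Y, S.f ≫ ψ = φ) :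
    Subsingleton (Ext S.X₃ Y 1) := by
  refine subsingleton_of_forall_eq 0 fun x => ?_
  obtain ⟨y, rfl⟩ := Ext.contravariant_sequence_exact₃ hS Y x (Subsingleton.elim _ _)
    (n₀ := 0) rfl
  obtain ⟨φ, rfl⟩ := (Ext.mk₀_bijective _ _).2 y
  obtain ⟨ψ, rfl⟩ := h φ
  rw [← Ext.mk₀_comp_mk₀, ← Ext.comp_assoc _ _ _ (by rfl) (by rfl) (by rfl)]
  simp

lemma subsingleton_ext_X₃_of_contravariant (hS : S.ShortExact) {Y : C} {n : ℕ}
    (h₁ : Subsingleton (Ext S.X₁ Y n)) (h₂ : Subsingleton (Ext S.X₂ Y (n + 1))) :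
    Subsingleton (Ext S.X₃ Y (n + 1)) := by
  refine subsingleton_of_forall_eq 0 fun x => ?_
  obtain ⟨y, rfl⟩ := Ext.contravariant_sequence_exact₃ hS Y x (Subsingleton.elim _ _)
    (n₀ := n) (add_comm _ _)
  rw [Subsingleton.elim y 0, Ext.comp_zero]

lemma subsingleton_ext_X₁_of_contravariant (hS : S.ShortExact) {Y : C} {n : ℕ}
    (h₂ : Subsingleton (Ext S.X₂ Y n)) (h₃ : Subsingleton (Ext S.X₃ Y (n + 1))) :
    Subsingleton (Ext S.X₁ Y n) := by
  refine subsingleton_of_forall_eq 0 fun x => ?_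
  obtain ⟨y, rfl⟩ := Ext.contravariant_sequence_exact₁ hS Y x (n₁ := n + 1) (add_comm _ _)
    (Subsingleton.elim _ _)
  rw [Subsingleton.elim y 0, Ext.comp_zero]

lemma subsingleton_ext_X₃_of_covariant (hS : S.ShortExact) {X : C} {n : ℕ}
    (h₁ : Subsingleton (Ext X S.X₁ (n + 1))) (h₂ : Subsingleton (Ext X S.X₂ n)) :
    Subsingleton (Ext X S.X₃ n) := by
  refine subsingleton_of_forall_eq 0 fun x => ?_
  obtain ⟨y, rfl⟩ := Ext.covariant_sequence_exact₃ X hS x (n₁ := n + 1) rfl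
    (Subsingleton.elim _ _)
  rw [Subsingleton.elim y 0, Ext.zero_comp]

end ShortExact

lemma ext_comp_mk₀_injective_of_shortExact {C : Type*} [Category* C] [Abelian C] [HasExt C]
    {S : ShortComplex C} (hS : S.ShortExact) {X : C} {n : ℕ}
    (h : ∀ i < n, Subsingleton (Ext X S.X₃ i)) (x : Ext X S.X₁ n)
    (hx : x.comp (Ext.mk₀ S.f) (add_zero n) = 0) : x = 0 := by
  cases n with
  | zero =>
    have := hS.mono_f
    exact Ext.postcomp_mk₀_injective_of_mono X S.f (by simpa using hx)
  | succ n =>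
    obtain ⟨y, rfl⟩ := Ext.covariant_sequence_exact₁ X hS x hx rfl
    have := h n n.lt_succ_self
    rw [Subsingleton.elim y 0, Ext.zero_comp]

section Modules

variable {R : Type u} [CommRing R]

lemma ext_pi_eq_zero {X : ModuleCat.{u} R} {n i : ℕ} (y : Ext X (ModuleCat.of R (Fin n → R)) i)
    (h : ∀ j, y.comp (Ext.mk₀ (ModuleCat.ofHom (LinearMap.proj j : (Fin n → R) →ₗ[R] R)))
      (add_zero i) = 0) : y = 0 := by
  have key : (𝟙 (ModuleCat.of R (Fin n → R))) =
      ∑ j, ModuleCat.ofHom (LinearMap.proj j : (Fin n → R) →ₗ[R] R) ≫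
        ModuleCat.ofHom (LinearMap.single R (fun _ => R) j) := by
    ext : 1
    simp only [ModuleCat.hom_id, ModuleCat.hom_sum, ModuleCat.hom_comp, ModuleCat.hom_ofHom]
    ext j k
    simp [Pi.single_apply]
  rw [← y.comp_mk₀_id, key, Ext.mk₀_sum, Ext.comp_sum]
  refine Finset.sum_eq_zero fun j _ => ?_
  rw [← Ext.mk₀_comp_mk₀, ← Ext.comp_assoc_of_third_deg_zero, h, Ext.zero_comp]

instance projective_of_module_projective (P : Type u) [AddCommGroup P] [Module R P]
    [Module.Projective R P] : Projective (ModuleCat.of R P) :=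
  (IsProjective.iff_projective P).1 inferInstance

lemma totReflexive_of_projective (P : Type u) [AddCommGroup P] [Module R P]
    [Module.Finite R P] [Module.Projective R P] : TotReflexive R P := by
  refine ⟨inferInstance, inferInstance, fun i hi => ?_, fun i hi => ?_⟩ <;>
  · obtain ⟨i, rfl⟩ := Nat.exists_eq_add_of_le' hi
    rw [subsingleton_extMod_iff]
    exact subsingleton_of_forall_eq 0 fun x => Ext.eq_zero_of_projective x

/-- The dual of a short exact sequence. -/
noncomputable abbrev dualShortComplex (S : ShortComplex (ModuleCat.{u} R)) :
    ShortComplex (ModuleCat.{u} R) :=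
  ModuleCat.shortComplexOfCompEqZero S.g.hom.dualMap S.f.hom.dualMap (by
    rw [LinearMap.dualMap_comp_dualMap, ← ModuleCat.hom_comp, S.zero]
    ext; simp)

lemma dualShortComplex_shortExact {S : ShortComplex (ModuleCat.{u} R)} (hS : S.ShortExact)
    (h : Function.Surjective S.f.hom.dualMap) : (dualShortComplex S).ShortExact := by
  have hg := hS.moduleCat_surjective_g
  have := hS.epi_g
  refine ModuleCat.shortComplex_shortExact _ (fun ψ => ⟨fun hψ => ?_, ?_⟩)
    (LinearMap.dualMap_injective_of_surjective hg) h
  · have h0 : S.f ≫ ModuleCat.ofHom ψ = 0 := by ext : 1; exact hψ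
    exact ⟨(hS.exact.desc _ h0).hom, congr(($(hS.exact.g_desc _ h0)).hom)⟩
  · rintro ⟨φ, rfl⟩
    exact congr(($((dualShortComplex S).zero)).hom φ)

theorem totReflexive_X₃ {S : ShortComplex (ModuleCat.{u} R)} (hS : S.ShortExact)
    (h₁ : TotReflexive R S.X₁) (h₂ : TotReflexive R S.X₂)
    (h : Function.Surjective S.f.hom.dualMap) : TotReflexive R S.X₃ := by
  have hg := hS.moduleCat_surjective_g
  have hD := dualShortComplex_shortExact hS h
  obtain ⟨fin₁, refl₁, ext₁, extD₁⟩ := h₁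
  obtain ⟨fin₂, refl₂, ext₂, extD₂⟩ := h₂
  simp only [subsingleton_extMod_iff] at ext₁ ext₂ extD₁ extD₂
  refine ⟨Module.Finite.of_surjective S.g.hom hg, ⟨?_, ?_⟩, fun i hi => ?_, fun i hi => ?_⟩
  · rw [injective_iff_map_eq_zero]
    intro c hc
    obtain ⟨b, rfl⟩ := hg c
    have := hD.epi_g
    have h0 : (dualShortComplex S).f ≫ ModuleCat.ofHom (Module.Dual.eval R S.X₂ b) = 0 := by
      ext : 1; exact hc
    obtain ⟨a, ha⟩ := (Module.bijective_dual_eval R S.X₁).2 (hD.exact.desc _ h0).hom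
    have hz := hD.exact.g_desc _ h0
    have hb : S.f a = b := by
      refine (Module.bijective_dual_eval R S.X₂).1 ?_
      ext θ
      exact congr($ha (S.f.hom.dualMap θ)).trans congr(($hz).hom θ)
    rw [← hb]
    exact congr(($(S.zero)).hom a)
  · intro x
    obtain ⟨y, hy⟩ := exists_comp_eq_of_subsingleton_ext_one hD (extD₁ 1 le_rfl)
      (ModuleCat.ofHom x)
    obtain ⟨b, hb⟩ := (Module.bijective_dual_eval R S.X₂).2 y.hom
    refine ⟨S.g b, ?_⟩
    ext ψ
    have h1 := congr($hb (S.g.hom.dualMap ψ))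
    have h2 := congr($(hy).hom ψ)
    exact h1.trans h2
  · rw [subsingleton_extMod_iff]
    obtain ⟨i, rfl⟩ := Nat.exists_eq_add_of_le' hi
    rcases i with _ | i
    · refine subsingleton_ext_one_of_forall_exists_comp_eq hS (ext₂ 1 le_rfl) fun φ => ?_
      obtain ⟨ψ, hψ⟩ := h φ.hom
      exact ⟨ModuleCat.ofHom ψ, by ext : 1; exact hψ⟩
    · exact subsingleton_ext_X₃_of_contravariant hS (ext₁ _ (by lia)) (ext₂ _ (by lia))
  · rw [subsingleton_extMod_iff]
    exact subsingleton_ext_X₁_of_contravariant hD (extD₂ i hi) (extD₁ _ (by lia))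

/-- The short complex `M ⟶ Rⁿ ⟶ Rⁿ / M` attached to `n` functionals on `M`. -/
noncomputable abbrev evaluationShortComplex {M : Type u} [AddCommGroup M] [Module R M] {n : ℕ}
    (φ : Fin n → Module.Dual R M) : ShortComplex (ModuleCat.{u} R) :=
  ModuleCat.shortComplexOfCompEqZero (LinearMap.pi φ) (LinearMap.range (LinearMap.pi φ)).mkQ
    (LinearMap.range_mkQ_comp _)

section Evaluation

variable {M : Type u} [AddCommGroup M] [Module R M] {n : ℕ} {φ : Fin n → Module.Dual R M}

lemma evaluationShortComplex_shortExact (hM : TotReflexive R M)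
    (hφ : Submodule.span R (Set.range φ) = ⊤) : (evaluationShortComplex φ).ShortExact := by
  have := hM.2.1
  refine ModuleCat.shortComplex_shortExact _ (LinearMap.exact_map_mkQ_range _) ?_
    (Submodule.mkQ_surjective _)
  refine (injective_iff_map_eq_zero (LinearMap.pi φ)).2 fun m hm => ?_
  refine (injective_iff_map_eq_zero _).1 (Module.bijective_dual_eval R M).1 m ?_
  ext ψ
  change ψ m = 0
  have hψ : ψ ∈ Submodule.span R (Set.range φ) := hφ ▸ Submodule.mem_top
  induction hψ using Submodule.span_induction with
  | mem x hx =>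
    obtain ⟨i, rfl⟩ := hx
    exact congr_fun hm i
  | zero => rfl
  | add x y _ _ hx hy => simp [hx, hy]
  | smul a x _ hx => simp [hx]

lemma totReflexive_evaluationShortComplex_X₃ (hM : TotReflexive R M)
    (hφ : Submodule.span R (Set.range φ) = ⊤) : TotReflexive R (evaluationShortComplex φ).X₃ := by
  refine totReflexive_X₃ (evaluationShortComplex_shortExact hM hφ) hM
    (totReflexive_of_projective _) fun ψ => ?_
  have hψ : ψ ∈ Submodule.span R (Set.range φ) := hφ ▸ Submodule.mem_top
  obtain ⟨c, rfl⟩ := (Submodule.mem_span_range_iff_exists_fun R).1 hψ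
  refine ⟨∑ i, c i • LinearMap.proj i, ?_⟩
  ext m
  simp

end Evaluation

lemma TotReflexive.finite_dual [IsNoetherianRing R] {M : Type u} [AddCommGroup M] [Module R M]
    (hM : TotReflexive R M) : Module.Finite R (Module.Dual R M) := by
  have := hM.1
  infer_instance

lemma TotReflexive.exists_span_range_dual_eq_top [IsNoetherianRing R] {M : Type u}
    [AddCommGroup M] [Module R M] (hM : TotReflexive R M) :
    ∃ (n : ℕ) (φ : Fin n → Module.Dual R M), Submodule.span R (Set.range φ) = ⊤ := by
  have := hM.finite_dual
  exact Module.Finite.exists_fin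

lemma TotReflexive.subsingleton_ext [IsNoetherianRing R] {X : ModuleCat.{u} R} {n : ℕ}
    (hX : ∀ i < n, Subsingleton (Ext X (ModuleCat.of R R) i)) {M : Type u}
    [AddCommGroup M] [Module R M] (hM : TotReflexive R M) :
    ∀ i < n, Subsingleton (Ext X (ModuleCat.of R M) i) := by
  intro i hi
  induction i using Nat.strong_induction_on generalizing M with
  | _ i ih =>
  obtain ⟨m, φ, hφ⟩ := hM.exists_span_range_dual_eq_top
  refine subsingleton_of_forall_eq 0 fun x => ext_comp_mk₀_injective_of_shortExact
    (evaluationShortComplex_shortExact hM hφ) (fun j hj => ?_) x (ext_pi_eq_zero _ fun j => ?_)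
  · exact ih j hj (totReflexive_evaluationShortComplex_X₃ hM hφ) (hj.trans hi)
  · have := hX i hi
    exact Subsingleton.elim _ _

/-- Elements of the lowest possible `Ext` group into a totally reflexive module are detected by
functionals. -/
lemma TotReflexive.ext_eq_zero [IsNoetherianRing R] {X : ModuleCat.{u} R} {n : ℕ}
    (hX : ∀ i < n, Subsingleton (Ext X (ModuleCat.of R R) i)) {M : Type u}
    [AddCommGroup M] [Module R M] (hM : TotReflexive R M) (x : Ext X (ModuleCat.of R M) n)
    (hx : ∀ φ : Module.Dual R M, x.comp (Ext.mk₀ (ModuleCat.ofHom φ)) (add_zero n) = 0) :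
    x = 0 := by
  obtain ⟨m, φ, hφ⟩ := hM.exists_span_range_dual_eq_top
  refine ext_comp_mk₀_injective_of_shortExact (evaluationShortComplex_shortExact hM hφ)
    ((totReflexive_evaluationShortComplex_X₃ hM hφ).subsingleton_ext hX) x
    (ext_pi_eq_zero _ fun j => ?_)
  rw [Ext.comp_assoc_of_third_deg_zero, Ext.mk₀_comp_mk₀]
  exact hx (φ j)

lemma totReflexive_of_subsingleton (M : Type u) [AddCommGroup M] [Module R M] [Subsingleton M] :
    TotReflexive R M :=
  totReflexive_of_projective M

variable [IsLocalRing R]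

variable (R) in
/-- The residue field of a local ring as a bundled module. -/
noncomputable abbrev residueFieldModule : ModuleCat.{u} R :=
  ModuleCat.of R (IsLocalRing.ResidueField R)

lemma smul_ext_residueField_eq_zero {Y : ModuleCat.{u} R} {n : ℕ}
    (x : Ext (residueFieldModule R) Y n) {r : R} (hr : r ∈ IsLocalRing.maximalIdeal R) :
    r • x = 0 := by
  have h0 : r • 𝟙 (residueFieldModule R) = 0 := by
    ext y
    simp [Algebra.smul_def, (IsLocalRing.residue_eq_zero_iff r).2 hr]
  rw [← Ext.mk₀_id_comp x, ← Ext.smul_comp, ← Ext.mk₀_smul, h0, Ext.mk₀_zero, Ext.zero_comp]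

/-- A nonzero functional on `M* ⊗ k` yields a nonzero element of `Ext (k, M)` in the lowest
possible degree, which is killed by all `φ` in the kernel of the functional. -/
lemma TotReflexive.exists_ext_ne_zero [IsNoetherianRing R] {n : ℕ}
    (hR : ∀ i < n, Subsingleton (Ext (residueFieldModule R) (ModuleCat.of R R) i))
    (e : Ext (residueFieldModule R) (ModuleCat.of R R) n) (he : e ≠ 0) {M : Type u}
    [AddCommGroup M] [Module R M] (hM : TotReflexive R M)
    (ℓ : Module.Dual R M →ₗ[R] IsLocalRing.ResidueField R) (hℓ : ℓ ≠ 0) :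
    ∃ x : Ext (residueFieldModule R) (ModuleCat.of R M) n, x ≠ 0 ∧
      ∀ φ : Module.Dual R M, ℓ φ = 0 →
        x.comp (Ext.mk₀ (ModuleCat.ofHom φ)) (add_zero n) = 0 := by
  obtain ⟨m, φ, hφ⟩ := hM.exists_span_range_dual_eq_top
  choose r hr using fun i => IsLocalRing.residue_surjective (ℓ (φ i))
  let j : R →ₗ[R] (Fin m → R) := LinearMap.toSpanSingleton R _ r
  have hcomp : ∀ ψ : (Fin m → R) →ₗ[R] R, ModuleCat.ofHom j ≫ ModuleCat.ofHom ψ =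
      ψ r • 𝟙 (ModuleCat.of R R) := by
    intro ψ
    ext
    simp [j]
  have hψr : ∀ ψ : (Fin m → R) →ₗ[R] R,
      IsLocalRing.residue R (ψ r) = ℓ (ψ ∘ₗ LinearMap.pi φ) := by
    intro ψ
    have h0 (v : Fin m → R) : ψ v = ∑ i, v i * ψ (Pi.single i 1) := by
      rw [LinearMap.pi_apply_eq_sum_univ ψ v]
      refine Finset.sum_congr rfl fun i _ => ?_
      rw [smul_eq_mul]
      congr 2
      ext k
      rw [Pi.single_apply]
      exact if_congr eq_comm rfl rfl
    have h1 : ψ ∘ₗ LinearMap.pi φ = ∑ i, ψ (Pi.single i 1) • φ i := by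
      ext m
      change ψ (LinearMap.pi φ m) = _
      rw [h0]
      simp [mul_comm]
    rw [h1, h0]
    simp only [map_sum, map_mul, map_smul, hr, Algebra.smul_def]
    exact Finset.sum_congr rfl fun i _ => mul_comm _ _
  let y : Ext (residueFieldModule R) (ModuleCat.of R (Fin m → R)) n :=
    e.comp (Ext.mk₀ (ModuleCat.ofHom j)) (add_zero n)
  have hy : ∀ ψ : (Fin m → R) →ₗ[R] R,
      y.comp (Ext.mk₀ (ModuleCat.ofHom ψ)) (add_zero n) = ψ r • e := by
    intro ψ
    rw [Ext.comp_assoc_of_third_deg_zero, Ext.mk₀_comp_mk₀, hcomp, ← Ext.smul_eq_comp_mk₀]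
  have hS := evaluationShortComplex_shortExact hM hφ
  have hC := totReflexive_evaluationShortComplex_X₃ hM hφ
  obtain ⟨x, hx⟩ := Ext.covariant_sequence_exact₂ (residueFieldModule R) hS y (by
    refine hC.ext_eq_zero hR _ fun θ => ?_
    rw [Ext.comp_assoc_of_third_deg_zero, Ext.mk₀_comp_mk₀]
    refine (hy (θ ∘ₗ Submodule.mkQ _)).trans (smul_ext_residueField_eq_zero e ?_)
    rw [← IsLocalRing.residue_eq_zero_iff, hψr, LinearMap.comp_assoc, LinearMap.range_mkQ_comp,
      LinearMap.comp_zero, map_zero])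
  refine ⟨x, ?_, fun θ hθ => ?_⟩
  · rintro rfl
    rw [Ext.zero_comp] at hx
    refine hℓ (LinearMap.ext_on_range hφ fun i => ?_)
    by_contra hi
    have hu : IsUnit (r i) := by
      by_contra hu
      exact hi ((hr i).symm.trans ((IsLocalRing.residue_eq_zero_iff _).2 hu))
    have h0 := hy (LinearMap.proj i)
    rw [← hx, Ext.zero_comp] at h0
    exact he (hu.smul_eq_zero.1 h0.symm)
  · have hθ' : θ ∈ Submodule.span R (Set.range φ) := hφ ▸ Submodule.mem_top
    obtain ⟨c, hc⟩ := (Submodule.mem_span_range_iff_exists_fun R).1 hθ'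
    let ψ : (Fin m → R) →ₗ[R] R := ∑ i, c i • LinearMap.proj i
    have hψ : ψ ∘ₗ LinearMap.pi φ = θ := by
      rw [← hc]
      ext m
      simp [ψ]
    have h1 := hy ψ
    rw [smul_ext_residueField_eq_zero e
      ((IsLocalRing.residue_eq_zero_iff _).1 (by rw [hψr, hψ, hθ])), ← hx,
      Ext.comp_assoc_of_third_deg_zero, Ext.mk₀_comp_mk₀] at h1
    rwa [← hψ]

lemma exists_residueField_linearMap_ne_zero {N : Type*} [AddCommGroup N] [Module R N]
    [Module.Finite R N] {I : Submodule R N} (hI : I ≠ ⊤) :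
    ∃ ℓ : N →ₗ[R] IsLocalRing.ResidueField R, ℓ ≠ 0 ∧ ∀ x ∈ I, ℓ x = 0 := by
  obtain ⟨P, hP, hIP⟩ := (eq_top_or_exists_le_coatom I).resolve_left hI
  have : IsSimpleModule R (N ⧸ P) := isSimpleModule_iff_isCoatom.2 hP
  obtain ⟨J, hJ, ⟨f⟩⟩ := isSimpleModule_iff_quot_maximal.1 this
  obtain rfl := IsLocalRing.eq_maximalIdeal hJ
  refine ⟨f.toLinearMap ∘ₗ P.mkQ, fun h => hP.1 ?_, fun x hx => ?_⟩
  · refine Submodule.eq_top_iff'.2 fun x => ?_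
    have hx : f (P.mkQ x) = 0 := congr($h x)
    simpa using hx
  · have : P.mkQ x = 0 := by simpa using hIP hx
    change f (P.mkQ x) = 0
    rw [this, map_zero]

section Depth

variable {M : Type u} [AddCommGroup M] [Module R M]

lemma le_eDepth_iff {n : ℕ} :
    (n : ℕ∞) ≤ eDepth R M ↔
      ∀ i < n, Subsingleton (Ext (residueFieldModule R) (ModuleCat.of R M) i) := by
  rw [eDepth, le_sInf_iff]
  constructor
  · intro h i hi
    rw [← subsingleton_extMod_iff, ← not_nontrivial_iff_subsingleton]
    intro hn
    exact absurd (h i ⟨i, rfl, hn⟩) (by simpa using hi)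
  · rintro h _ ⟨i, rfl, hi⟩
    by_contra hlt
    have := (subsingleton_extMod_iff i _ _).2 (h i (by simpa using hlt))
    exact not_subsingleton _ this

lemma eDepth_le {n : ℕ} {x : Ext (residueFieldModule R) (ModuleCat.of R M) n} (hx : x ≠ 0) :
    eDepth R M ≤ n := by
  refine sInf_le ⟨n, rfl, ?_⟩
  rw [← not_subsingleton_iff_nontrivial, subsingleton_extMod_iff]
  exact fun _ => hx (Subsingleton.elim _ _)

lemma exists_ext_ne_zero_of_eDepth_eq {n : ℕ} (h : eDepth R M = n) :
    ∃ x : Ext (residueFieldModule R) (ModuleCat.of R M) n, x ≠ 0 := by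
  by_contra! hx
  have h1 : ((n + 1 : ℕ) : ℕ∞) ≤ eDepth R M := le_eDepth_iff.2 fun i hi => by
    rcases Nat.lt_succ_iff_lt_or_eq.1 hi with hi | rfl
    · exact le_eDepth_iff.1 h.ge i hi
    · exact subsingleton_of_forall_eq 0 hx
  rw [h, Nat.cast_le] at h1
  lia

lemma eDepth_eq_top_iff :
    eDepth R M = ⊤ ↔ ∀ i, Subsingleton (Ext (residueFieldModule R) (ModuleCat.of R M) i) := by
  rw [ENat.eq_top_iff_forall_ge]
  simp only [le_eDepth_iff]
  exact ⟨fun h i => h (i + 1) i i.lt_succ_self, fun h _ i _ => h i⟩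

end Depth

theorem TotReflexive.eDepth_eq [IsNoetherianRing R] {M : Type u} [AddCommGroup M] [Module R M]
    [Nontrivial M] (hM : TotReflexive R M) : eDepth R M = eDepth R R := by
  have key {n : ℕ} (hn : (n : ℕ∞) ≤ eDepth R R) : (n : ℕ∞) ≤ eDepth R M :=
    le_eDepth_iff.2 (hM.subsingleton_ext (le_eDepth_iff.1 hn))
  refine le_antisymm ?_ (ENat.forall_natCast_le_iff_le.1 fun n => key)
  rcases h : eDepth R R with _ | n
  · exact le_top
  · have hn : eDepth R R = n := h
    have := hM.finite_dual
    have := hM.2.1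
    obtain ⟨e, he⟩ := exists_ext_ne_zero_of_eDepth_eq hn
    have : Nontrivial (Module.Dual R M) := by
      by_contra! h
      refine not_subsingleton M ⟨fun a b => (Module.bijective_dual_eval R M).1 ?_⟩
      ext ψ
      rw [Subsingleton.elim ψ 0]
      simp
    obtain ⟨ℓ, hℓ, -⟩ :=
      exists_residueField_linearMap_ne_zero (bot_ne_top : (⊥ : Submodule R (Module.Dual R M)) ≠ ⊤)
    obtain ⟨x, hx, -⟩ := hM.exists_ext_ne_zero (le_eDepth_iff.1 hn.ge) e he ℓ hℓ
    exact eDepth_le hx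

lemma eDepth_X₃_eq_top {S : ShortComplex (ModuleCat.{u} R)} (hS : S.ShortExact)
    (h₁ : eDepth R S.X₁ = ⊤) (h₂ : eDepth R S.X₂ = ⊤) : eDepth R S.X₃ = ⊤ := by
  rw [eDepth_eq_top_iff] at *
  exact fun i => subsingleton_ext_X₃_of_covariant hS (h₁ _) (h₂ _)

/-- The depth drops by one along a short exact sequence as soon as the map
`Ext (k, X₁) ⟶ Ext (k, X₂)` is not injective in degree `depth X₁ ≤ depth X₂`. -/
lemma eDepth_X₃_add_one {S : ShortComplex (ModuleCat.{u} R)} (hS : S.ShortExact) {n : ℕ}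
    (h₁ : n ≤ eDepth R S.X₁) (h₂ : n ≤ eDepth R S.X₂)
    {x : Ext (residueFieldModule R) S.X₁ n} (hx : x ≠ 0)
    (hxf : x.comp (Ext.mk₀ S.f) (add_zero n) = 0) : eDepth R S.X₃ + 1 = n := by
  rw [le_eDepth_iff] at h₁ h₂
  rcases n with _ | n
  · exact absurd (ext_comp_mk₀_injective_of_shortExact hS (by simp) x hxf) hx
  · obtain ⟨y, rfl⟩ := Ext.covariant_sequence_exact₁ (residueFieldModule R) hS x hxf rfl
    have hy : y ≠ 0 := by
      rintro rfl
      exact hx (Ext.zero_comp ..)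
    have : eDepth R S.X₃ = n := le_antisymm (eDepth_le hy) (le_eDepth_iff.2 fun i hi =>
      subsingleton_ext_X₃_of_covariant hS (h₁ _ (by lia)) (h₂ _ (by lia)))
    rw [this]
    rfl

theorem eDepth_add_eq_of_gdimLE [IsNoetherianRing R] {n : ℕ} {M : ModuleCat.{u} R}
    (hM : GdimLE R n M) (hmin : ∀ k < n, ¬ GdimLE R k M) (hM0 : Nontrivial M) :
    eDepth R M + n = eDepth R R := by
  induction hM with
  | zero M h => simpa using h.eDepth_eq
  | succ n M K G hG f g hf hfg hg hK ih =>
    let S : ShortComplex (ModuleCat.{u} R) := ShortComplex.mk f g (by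
      ext x
      exact hfg.apply_apply_eq_zero x)
    have hS : S.ShortExact := ModuleCat.shortComplex_shortExact S hfg hf hg
    have hminK : ∀ k < n, ¬ GdimLE R k K := fun k hk hKk =>
      hmin (k + 1) (by lia) (.succ k M K G hG f g hf hfg hg hKk)
    have hTR : ¬ TotReflexive R M := fun h => hmin 0 (by lia) (.zero M h)
    have : Nontrivial G := hg.nontrivial
    have : Nontrivial K := by
      by_contra! hK0
      have hK0 := totReflexive_of_subsingleton (R := R) K
      refine hTR (totReflexive_X₃ hS hK0 hG fun φ => ⟨0, ?_⟩)
      ext x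
      rw [Subsingleton.elim x 0, map_zero, map_zero]
    have hdG := hG.eDepth_eq
    have hdK := ih hminK inferInstance
    obtain ht | ⟨t, ht⟩ : eDepth R R = ⊤ ∨ ∃ t : ℕ, eDepth R R = t := by
      cases h : eDepth R R <;> simp
    · have h1 : eDepth R K = ⊤ := by
        rw [ht] at hdK
        simpa using hdK
      rw [ht, eDepth_X₃_eq_top hS h1 (hdG.trans ht), top_add]
    · rw [ht] at hdK hdG
      obtain ⟨s, hs⟩ : ∃ s : ℕ, eDepth R K = s := by
        refine ENat.ne_top_iff_exists.1 ?_ |>.imp fun _ => Eq.symm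
        intro h
        simp [h] at hdK
      have hst : s + n = t := by
        rw [hs] at hdK
        exact_mod_cast hdK
      obtain ⟨x, hx, hxf⟩ : ∃ x : Ext (residueFieldModule R) S.X₁ s, x ≠ 0 ∧
          x.comp (Ext.mk₀ S.f) (add_zero s) = 0 := by
        rcases n.eq_zero_or_pos with rfl | hn
        · obtain rfl : s = t := hst
          have hK' : TotReflexive R K := by cases hK; assumption
          have hI : LinearMap.range S.f.hom.dualMap ≠ ⊤ := fun h =>
            hTR (totReflexive_X₃ hS hK' hG (LinearMap.range_eq_top.1 h))
          have := hK'.finite_dual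
          obtain ⟨ℓ, hℓ, hℓI⟩ :=
            exists_residueField_linearMap_ne_zero (N := Module.Dual R K) hI
          have hR := le_eDepth_iff.1 ht.ge
          obtain ⟨e, he⟩ := exists_ext_ne_zero_of_eDepth_eq ht
          obtain ⟨x, hx, hxℓ⟩ := hK'.exists_ext_ne_zero hR e he ℓ hℓ
          refine ⟨x, hx, hG.ext_eq_zero hR _ fun ψ => ?_⟩
          rw [Ext.comp_assoc_of_third_deg_zero, Ext.mk₀_comp_mk₀]
          exact hxℓ _ (hℓI _ ⟨ψ, rfl⟩)
        · obtain ⟨x, hx⟩ := exists_ext_ne_zero_of_eDepth_eq hs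
          have := le_eDepth_iff.1 hdG.ge s (by lia)
          exact ⟨x, hx,
            Subsingleton.elim (α := Ext (residueFieldModule R) (ModuleCat.of R G) s) _ _⟩
      have := eDepth_X₃_add_one hS hs.ge (hdG ▸ by exact_mod_cast (by lia : s ≤ t)) hx hxf
      change eDepth R S.X₃ + _ = _
      rw [ht, Nat.cast_add, Nat.cast_one, add_comm (n : ℕ∞) 1, ← add_assoc, this]
      exact_mod_cast hst

end Modules


lemma gdim_le {R : Type u} [CommRing R] {n : ℕ} {M : ModuleCat.{u} R} (hM : GdimLE R n M) :
    gdim R M ≤ n :=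
  sInf_le ⟨n, rfl, hM⟩

lemma exists_gdim_eq {R : Type u} [CommRing R] {M : ModuleCat.{u} R} (hM : gdim R M ≠ ⊤) :
    ∃ n : ℕ, gdim R M = n ∧ GdimLE R n M := by
  refine csInf_mem (s := {n : ℕ∞ | ∃ k : ℕ, n = k ∧ GdimLE R k M}) ?_
  by_contra! h
  exact hM (by rw [gdim, h, sInf_empty])

/-- the Auslander–Bridger formula:
`depth M + G-dim_R M = depth R` for a nonzero module of finite Gorenstein dimension. -/
theorem stmt_13 (R : Type u) [CommRing R] [IsNoetherianRing R] [IsLocalRing R]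
    (M : Type u) [AddCommGroup M] [Module R M] [Module.Finite R M] [Nontrivial M]
    (hfin : gdim R (ModuleCat.of R M) ≠ ⊤) :
    eDepth R M + gdim R (ModuleCat.of R M) = eDepth R R := by
  obtain ⟨k, hgdim, hM⟩ := exists_gdim_eq hfin
  have hmin : ∀ j < k, ¬ GdimLE R j (ModuleCat.of R M) := fun j hj hMj => by
    have h := gdim_le hMj
    rw [hgdim, Nat.cast_le] at h
    exact hj.not_ge h
  have key := eDepth_add_eq_of_gdimLE hM hmin ‹Nontrivial M›
  rw [hgdim]
  exact key
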